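/- Let A be a twisted form of K₁₀ over F. Then either A is isomorphic to K₁₀ as an F-superalgebra, or there exists a quadratic separable field extension K of F such that A ⊗_F K is isomorphic to K₁₀ ⊗_F K as K-superalgebras. -/

import Mathlib

open scoped TensorProduct
noncomputable section
namespace Kac

/-! ### Superalgebra isomorphisms and automorphisms -/

@[ext]
structure SuperIso (S A B : Type) [CommRing S]
    [AddCommGroup A] [Module S A] [Mul A]
    [AddCommGroup B] [Module S B] [Mul B]
    (evA odA : Submodule S A) (evB odB : Submodule S B) : Type where
  e : A ≃ₗ[S] B
  map_mul' : ∀ x y : A, e (x * y) = e x * e y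
  map_even : evA.map e.toLinearMap = evB
  map_odd : odA.map e.toLinearMap = odB

abbrev SuperAut (S A : Type) [CommRing S] [AddCommGroup A] [Module S A] [Mul A]
    (ev od : Submodule S A) := SuperIso S A A ev od ev od

namespace SuperAut

variable {S A : Type} [CommRing S] [AddCommGroup A] [Module S A] [Mul A]
variable {ev od : Submodule S A}

private lemma map_symm {f : A ≃ₗ[S] A} {p : Submodule S A}
    (h : p.map f.toLinearMap = p) : p.map f.symm.toLinearMap = p := by
  have h2 : f.symm.toLinearMap.comp f.toLinearMap = LinearMap.id := by
    ext x; simp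
  calc p.map f.symm.toLinearMap
      = (p.map f.toLinearMap).map f.symm.toLinearMap := by rw [h]
    _ = p.map (f.symm.toLinearMap.comp f.toLinearMap) := by
        rw [Submodule.map_comp]
    _ = p := by rw [h2, Submodule.map_id]

instance : Group (SuperAut S A ev od) where
  one := ⟨LinearEquiv.refl S A, fun _ _ => rfl, Submodule.map_id _, Submodule.map_id _⟩
  mul f g := ⟨g.e.trans f.e,
    fun x y => by simp [LinearEquiv.trans_apply, g.map_mul', f.map_mul'],
    by rw [LinearEquiv.coe_trans, Submodule.map_comp, g.map_even, f.map_even],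
    by rw [LinearEquiv.coe_trans, Submodule.map_comp, g.map_odd, f.map_odd]⟩
  inv f := ⟨f.e.symm,
    fun x y => f.e.injective <| by simp [f.map_mul'],
    map_symm f.map_even, map_symm f.map_odd⟩
  mul_assoc f g h := by apply SuperIso.ext; apply LinearEquiv.ext; intro x; rfl
  one_mul f := by apply SuperIso.ext; apply LinearEquiv.ext; intro x; rfl
  mul_one f := by apply SuperIso.ext; apply LinearEquiv.ext; intro x; rfl
  inv_mul_cancel f := by
    apply SuperIso.ext; apply LinearEquiv.ext; intro x
    exact f.e.symm_apply_apply x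

end SuperAut

/-- The predicate that a pair of submodules `ev`, `od` makes a non-unital
(possibly non-associative) algebra `B` into a superalgebra. -/
def IsSuperalgebra (S B : Type) [CommRing S] [NonUnitalNonAssocRing B] [Module S B]
    (ev od : Submodule S B) : Prop :=
  ev ⊔ od = ⊤ ∧ ev ⊓ od = ⊥ ∧
  (∀ x ∈ ev, ∀ y ∈ ev, x * y ∈ ev) ∧ (∀ x ∈ ev, ∀ y ∈ od, x * y ∈ od) ∧
  (∀ x ∈ od, ∀ y ∈ ev, x * y ∈ od) ∧ (∀ x ∈ od, ∀ y ∈ od, x * y ∈ ev)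

/-! ### Submodules given by vanishing of coordinates -/

def stdSub (S R : Type) [Semiring S] [AddCommGroup R] [Module S R] (n : ℕ)
    (s : Set (Fin n)) : Submodule S (Fin n → R) where
  carrier := {x | ∀ i, i ∉ s → x i = 0}
  add_mem' := fun {a b} ha hb i hi => by
    simp [Pi.add_apply, ha i hi, hb i hi]
  zero_mem' := fun i _ => rfl
  smul_mem' := fun c x hx i hi => by
    simp [Pi.smul_apply, hx i hi]

/-! ### Gradings by abelian groups -/

section Gradings

variable {G H S A : Type} [CommGroup G] [CommGroup H] [CommRing S]
  [AddCommGroup A] [Module S A] [Mul A]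

/-- `comp` is a `G`-grading of the superalgebra `(A, ev, od)`. -/
def IsSuperGrading (ev od : Submodule S A) (comp : G → Submodule S A) : Prop :=
  (letI := Classical.decEq G; DirectSum.IsInternal comp) ∧
  (∀ (g h : G) (x y : A), x ∈ comp g → y ∈ comp h → x * y ∈ comp (g * h)) ∧
  (∀ g, comp g = (comp g ⊓ ev) ⊔ (comp g ⊓ od))

/-- The grading with homogeneous elements `w i` of degrees `d i`. -/
def gradingOf (S : Type) {A G : Type} [CommRing S] [AddCommGroup A] [Module S A]
    [CommGroup G] {n : ℕ} (w : Fin n → A) (d : Fin n → G) : G → Submodule S A :=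
  fun g => Submodule.span S (w '' {i | d i = g})

/-- Isomorphism of two `G`-gradings on a superalgebra. -/
def GradIso (ev od : Submodule S A) (comp comp' : G → Submodule S A) : Prop :=
  ∃ φ : SuperAut S A ev od, ∀ g, (comp g).map φ.e.toLinearMap = comp' g

/-- `Δ` refines `Γ`. -/
def Refines (Δ : H → Submodule S A) (Γ : G → Submodule S A) : Prop :=
  ∀ h, Δ h ≠ ⊥ → ∃ g, Δ h ≤ Γ g

/-- Equivalence of a `G`-grading and an `H`-grading on a superalgebra. -/
def GradEquiv (ev od : Submodule S A) (Γ : G → Submodule S A)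
    (Δ : H → Submodule S A) : Prop :=
  ∃ φ : SuperAut S A ev od, ∃ α : {g : G // Γ g ≠ ⊥} → {h : H // Δ h ≠ ⊥},
    Function.Bijective α ∧
    ∀ g : {g : G // Γ g ≠ ⊥}, (Γ g.1).map φ.e.toLinearMap = Δ (α g).1

/-- A grading is fine if any grading refining it has the same nonzero
homogeneous components. -/
def IsFine (ev od : Submodule S A) (Γ : G → Submodule S A) : Prop :=
  ∀ (H : Type) (_ : CommGroup H) (Δ : H → Submodule S A),
    IsSuperGrading ev od Δ → Refines Δ Γ →
      {p : Submodule S A | p ≠ ⊥ ∧ ∃ h, Δ h = p} =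
      {p : Submodule S A | p ≠ ⊥ ∧ ∃ g, Γ g = p}

end Gradings

/-! ### SL₂ and the semidirect product with C₂ -/

abbrev SL2 (R : Type) [CommRing R] := Matrix.SpecialLinearGroup (Fin 2) R

def swapAut (M : Type) [Monoid M] : MulAut (M × M) := MulEquiv.prodComm

lemma swapAut_sq (M : Type) [Monoid M] : swapAut M * swapAut M = 1 :=
  MulEquiv.ext fun _ => rfl

/-- The action of `C₂ = Multiplicative (ZMod 2)` on `M × M` by swapping the factors. -/
def swapHom (M : Type) [Group M] : Multiplicative (ZMod 2) →* MulAut (M × M) :=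
  MonoidHom.mk' (fun c => if c.toAdd = 0 then 1 else swapAut M) (by
    intro a b
    have key : ∀ c : Multiplicative (ZMod 2),
        c = Multiplicative.ofAdd 0 ∨ c = Multiplicative.ofAdd 1 := by decide
    rcases key a with rfl | rfl <;> rcases key b with rfl | rfl <;>
      simp [← ofAdd_add, swapAut_sq] <;> exact fun h => absurd (by decide) h)

end Kac
/-! ### The (base-changed) Kaplansky superalgebra `K₃ ⊗ R` -/

namespace Kac

section Algebras

variable (F : Type) [Field F] (R : Type) [CommRing R] [Algebra F R]

/-- Coordinates: `0 ↦ a`, `1 ↦ u`, `2 ↦ v`. -/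
def K3A (F : Type) [Field F] (R : Type) [CommRing R] [Algebra F R] : Type := Fin 3 → R

instance : AddCommGroup (K3A F R) := Pi.addCommGroup
instance (S : Type) [Semiring S] [Module S R] : Module S (K3A F R) := Pi.module _ _ _

namespace K3A
variable {F R}

def mulFun (x y : K3A F R) : K3A F R := fun i =>
  match i with
  | ⟨0, _⟩ => x 0 * y 0 + (x 1 * y 2 - x 2 * y 1)
  | ⟨1, _⟩ => algebraMap F R 2⁻¹ * (x 0 * y 1 + y 0 * x 1)
  | ⟨2, _⟩ => algebraMap F R 2⁻¹ * (x 0 * y 2 + y 0 * x 2)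

instance : Mul (K3A F R) := ⟨mulFun⟩

lemma mul_def (x y : K3A F R) : x * y = mulFun x y := rfl

@[simp] lemma add_apply (x y : K3A F R) (i : Fin 3) : (x + y) i = x i + y i := rfl
@[simp] lemma sub_apply (x y : K3A F R) (i : Fin 3) : (x - y) i = x i - y i := rfl
@[simp] lemma neg_apply (x : K3A F R) (i : Fin 3) : (-x) i = -(x i) := rfl
@[simp] lemma zero_apply (i : Fin 3) : (0 : K3A F R) i = 0 := rfl
@[simp] lemma smul_apply (S : Type) [Semiring S] [Module S R] (c : S) (x : K3A F R) (i : Fin 3) :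
    (c • x) i = c • (x i) := rfl

variable (F R)

/-- The even part `R·a`. -/
def even (S : Type) [Semiring S] [Module S R] : Submodule S (K3A F R) := stdSub S R 3 {0}
/-- The odd part `W ⊗ R`. -/
def odd (S : Type) [Semiring S] [Module S R] : Submodule S (K3A F R) := stdSub S R 3 {1, 2}

/-- The element `a`. -/
def aE : K3A F R := ![1, 0, 0]
/-- The element of `W ⊗ R` with coordinates `w` in the symplectic basis `{u, v}`. -/
def wE (w : Fin 2 → R) : K3A F R := ![0, w 0, w 1]

end K3A

/-- `J(W) ⊗ R`; coordinates: `0 ↦ 1`, `1 ↦ u`, `2 ↦ v`. -/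
def JW1A (R : Type) [CommRing R] : Type := Fin 3 → R

instance : AddCommGroup (JW1A R) := Pi.addCommGroup
instance (S : Type) [Semiring S] [Module S R] : Module S (JW1A R) := Pi.module _ _ _

namespace JW1A
variable {R}

def mulFun (x y : JW1A R) : JW1A R := fun i =>
  match i with
  | ⟨0, _⟩ => x 0 * y 0 + (x 1 * y 2 - x 2 * y 1)
  | ⟨1, _⟩ => x 0 * y 1 + y 0 * x 1
  | ⟨2, _⟩ => x 0 * y 2 + y 0 * x 2

instance : Mul (JW1A R) := ⟨mulFun⟩

lemma mul_def (x y : JW1A R) : x * y = mulFun x y := rfl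

@[simp] lemma add_apply (x y : JW1A R) (i : Fin 3) : (x + y) i = x i + y i := rfl
@[simp] lemma sub_apply (x y : JW1A R) (i : Fin 3) : (x - y) i = x i - y i := rfl
@[simp] lemma neg_apply (x : JW1A R) (i : Fin 3) : (-x) i = -(x i) := rfl
@[simp] lemma zero_apply (i : Fin 3) : (0 : JW1A R) i = 0 := rfl
@[simp] lemma smul_apply (S : Type) [Semiring S] [Module S R] (c : S) (x : JW1A R) (i : Fin 3) :
    (c • x) i = c • (x i) := rfl

variable (R)

def even (S : Type) [Semiring S] [Module S R] : Submodule S (JW1A R) := stdSub S R 3 {0}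
def odd (S : Type) [Semiring S] [Module S R] : Submodule S (JW1A R) := stdSub S R 3 {1, 2}

def oneE : JW1A R := ![1, 0, 0]
def wE (w : Fin 2 → R) : JW1A R := ![0, w 0, w 1]

end JW1A

/-- `(K₃ × K₃) ⊗ R`; coordinates `0,1,2` for the first copy (`a,u,v`),
`3,4,5` for the second copy. -/
def K33A (F : Type) [Field F] (R : Type) [CommRing R] [Algebra F R] : Type := Fin 6 → R

instance : AddCommGroup (K33A F R) := Pi.addCommGroup
instance (S : Type) [Semiring S] [Module S R] : Module S (K33A F R) := Pi.module _ _ _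

namespace K33A
variable {F R}

def mulFun (x y : K33A F R) : K33A F R := fun i =>
  match i with
  | ⟨0, _⟩ => x 0 * y 0 + (x 1 * y 2 - x 2 * y 1)
  | ⟨1, _⟩ => algebraMap F R 2⁻¹ * (x 0 * y 1 + y 0 * x 1)
  | ⟨2, _⟩ => algebraMap F R 2⁻¹ * (x 0 * y 2 + y 0 * x 2)
  | ⟨3, _⟩ => x 3 * y 3 + (x 4 * y 5 - x 5 * y 4)
  | ⟨4, _⟩ => algebraMap F R 2⁻¹ * (x 3 * y 4 + y 3 * x 4)
  | ⟨5, _⟩ => algebraMap F R 2⁻¹ * (x 3 * y 5 + y 3 * x 5)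

instance : Mul (K33A F R) := ⟨mulFun⟩

lemma mul_def (x y : K33A F R) : x * y = mulFun x y := rfl

@[simp] lemma add_apply (x y : K33A F R) (i : Fin 6) : (x + y) i = x i + y i := rfl
@[simp] lemma sub_apply (x y : K33A F R) (i : Fin 6) : (x - y) i = x i - y i := rfl
@[simp] lemma neg_apply (x : K33A F R) (i : Fin 6) : (-x) i = -(x i) := rfl
@[simp] lemma zero_apply (i : Fin 6) : (0 : K33A F R) i = 0 := rfl
@[simp] lemma smul_apply (S : Type) [Semiring S] [Module S R] (c : S) (x : K33A F R) (i : Fin 6) :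
    (c • x) i = c • (x i) := rfl

variable (F R)

def even (S : Type) [Semiring S] [Module S R] : Submodule S (K33A F R) := stdSub S R 6 {0, 3}
def odd (S : Type) [Semiring S] [Module S R] : Submodule S (K33A F R) := stdSub S R 6 {1, 2, 4, 5}

/-- The element `(a, 0)`. -/
def aLeft : K33A F R := ![1, 0, 0, 0, 0, 0]
/-- The element `(0, a)`. -/
def aRight : K33A F R := ![0, 0, 0, 1, 0, 0]
/-- The element `(v, w)` of the odd part, `v, w ∈ W ⊗ R`. -/
def oddE (w w' : Fin 2 → R) : K33A F R := ![0, w 0, w 1, 0, w' 0, w' 1]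
/-- The exchange automorphism `(x, y) ↦ (y, x)`. -/
def swapFun (x : K33A F R) : K33A F R := fun i =>
  match i with
  | ⟨0, _⟩ => x 3
  | ⟨1, _⟩ => x 4
  | ⟨2, _⟩ => x 5
  | ⟨3, _⟩ => x 0
  | ⟨4, _⟩ => x 1
  | ⟨5, _⟩ => x 2

end K33A

/-- `(J(W) × J(W)) ⊗ R`. -/
def JW2A (R : Type) [CommRing R] : Type := Fin 6 → R

instance : AddCommGroup (JW2A R) := Pi.addCommGroup
instance (S : Type) [Semiring S] [Module S R] : Module S (JW2A R) := Pi.module _ _ _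

namespace JW2A
variable {R}

def mulFun (x y : JW2A R) : JW2A R := fun i =>
  match i with
  | ⟨0, _⟩ => x 0 * y 0 + (x 1 * y 2 - x 2 * y 1)
  | ⟨1, _⟩ => x 0 * y 1 + y 0 * x 1
  | ⟨2, _⟩ => x 0 * y 2 + y 0 * x 2
  | ⟨3, _⟩ => x 3 * y 3 + (x 4 * y 5 - x 5 * y 4)
  | ⟨4, _⟩ => x 3 * y 4 + y 3 * x 4
  | ⟨5, _⟩ => x 3 * y 5 + y 3 * x 5

instance : Mul (JW2A R) := ⟨mulFun⟩

lemma mul_def (x y : JW2A R) : x * y = mulFun x y := rfl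

@[simp] lemma add_apply (x y : JW2A R) (i : Fin 6) : (x + y) i = x i + y i := rfl
@[simp] lemma sub_apply (x y : JW2A R) (i : Fin 6) : (x - y) i = x i - y i := rfl
@[simp] lemma neg_apply (x : JW2A R) (i : Fin 6) : (-x) i = -(x i) := rfl
@[simp] lemma zero_apply (i : Fin 6) : (0 : JW2A R) i = 0 := rfl
@[simp] lemma smul_apply (S : Type) [Semiring S] [Module S R] (c : S) (x : JW2A R) (i : Fin 6) :
    (c • x) i = c • (x i) := rfl

variable (R)

def even (S : Type) [Semiring S] [Module S R] : Submodule S (JW2A R) := stdSub S R 6 {0, 3}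
def odd (S : Type) [Semiring S] [Module S R] : Submodule S (JW2A R) := stdSub S R 6 {1, 2, 4, 5}

/-- The element `(1, 0)`. -/
def oneLeft : JW2A R := ![1, 0, 0, 0, 0, 0]
/-- The element `(0, 1)`. -/
def oneRight : JW2A R := ![0, 0, 0, 1, 0, 0]
def oddE (w w' : Fin 2 → R) : JW2A R := ![0, w 0, w 1, 0, w' 0, w' 1]
def swapFun (x : JW2A R) : JW2A R := fun i =>
  match i with
  | ⟨0, _⟩ => x 3
  | ⟨1, _⟩ => x 4
  | ⟨2, _⟩ => x 5
  | ⟨3, _⟩ => x 0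
  | ⟨4, _⟩ => x 1
  | ⟨5, _⟩ => x 2

end JW2A

/-- Kac's superalgebra `K₁₀ ⊗ R`.  CoordinatesL `0 ↦ 1`, `1 ↦ a⊗a`,
`2 ↦ u⊗u`, `3 ↦ u⊗v`, `4 ↦ v⊗u`, `5 ↦ v⊗v`, `6 ↦ u⊗a`, `7 ↦ v⊗a`,
`8 ↦ a⊗u`, `9 ↦ a⊗v`. -/
def K10A (F : Type) [Field F] (R : Type) [CommRing R] [Algebra F R] : Type := Fin 10 → R

instance : AddCommGroup (K10A F R) := Pi.addCommGroup
instance (S : Type) [Semiring S] [Module S R] : Module S (K10A F R) := Pi.module _ _ _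

namespace K10A
variable {F R}

def mulFun (x y : K10A F R) : K10A F R := fun i =>
  match i with
  | ⟨0, _⟩ => x 0 * y 0 - algebraMap F R (3/16) * (x 1 * y 1)
      + algebraMap F R (3/4) * (x 2 * y 5 + x 5 * y 2 - x 3 * y 4 - x 4 * y 3)
      - algebraMap F R (3/8) * (x 6 * y 7 - x 7 * y 6 + x 8 * y 9 - x 9 * y 8)
  | ⟨1, _⟩ => x 0 * y 1 + x 1 * y 0 + x 1 * y 1
      - (x 2 * y 5 + x 5 * y 2 - x 3 * y 4 - x 4 * y 3)
      + (x 6 * y 7 - x 7 * y 6) + (x 8 * y 9 - x 9 * y 8)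
  | ⟨2, _⟩ => x 0 * y 2 + x 2 * y 0 + algebraMap F R 4⁻¹ * (x 1 * y 2 + x 2 * y 1)
      + algebraMap F R 4⁻¹ * (x 6 * y 8 - x 8 * y 6)
  | ⟨3, _⟩ => x 0 * y 3 + x 3 * y 0 + algebraMap F R 4⁻¹ * (x 1 * y 3 + x 3 * y 1)
      + algebraMap F R 4⁻¹ * (x 6 * y 9 - x 9 * y 6)
  | ⟨4, _⟩ => x 0 * y 4 + x 4 * y 0 + algebraMap F R 4⁻¹ * (x 1 * y 4 + x 4 * y 1)
      + algebraMap F R 4⁻¹ * (x 7 * y 8 - x 8 * y 7)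
  | ⟨5, _⟩ => x 0 * y 5 + x 5 * y 0 + algebraMap F R 4⁻¹ * (x 1 * y 5 + x 5 * y 1)
      + algebraMap F R 4⁻¹ * (x 7 * y 9 - x 9 * y 7)
  | ⟨6, _⟩ => x 0 * y 6 + x 6 * y 0 + algebraMap F R 2⁻¹ * (x 1 * y 6 + x 6 * y 1)
      + algebraMap F R 2⁻¹ * (x 2 * y 9 + x 9 * y 2) - algebraMap F R 2⁻¹ * (x 3 * y 8 + x 8 * y 3)
  | ⟨7, _⟩ => x 0 * y 7 + x 7 * y 0 + algebraMap F R 2⁻¹ * (x 1 * y 7 + x 7 * y 1)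
      + algebraMap F R 2⁻¹ * (x 4 * y 9 + x 9 * y 4) - algebraMap F R 2⁻¹ * (x 5 * y 8 + x 8 * y 5)
  | ⟨8, _⟩ => x 0 * y 8 + x 8 * y 0 + algebraMap F R 2⁻¹ * (x 1 * y 8 + x 8 * y 1)
      - algebraMap F R 2⁻¹ * (x 2 * y 7 + x 7 * y 2) + algebraMap F R 2⁻¹ * (x 4 * y 6 + x 6 * y 4)
  | ⟨9, _⟩ => x 0 * y 9 + x 9 * y 0 + algebraMap F R 2⁻¹ * (x 1 * y 9 + x 9 * y 1)
      - algebraMap F R 2⁻¹ * (x 3 * y 7 + x 7 * y 3) + algebraMap F R 2⁻¹ * (x 5 * y 6 + x 6 * y 5)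

instance : Mul (K10A F R) := ⟨mulFun⟩

lemma mul_def (x y : K10A F R) : x * y = mulFun x y := rfl

@[simp] lemma add_apply (x y : K10A F R) (i : Fin 10) : (x + y) i = x i + y i := rfl
@[simp] lemma sub_apply (x y : K10A F R) (i : Fin 10) : (x - y) i = x i - y i := rfl
@[simp] lemma neg_apply (x : K10A F R) (i : Fin 10) : (-x) i = -(x i) := rfl
@[simp] lemma zero_apply (i : Fin 10) : (0 : K10A F R) i = 0 := rfl
@[simp] lemma smul_apply (S : Type) [Semiring S] [Module S R] (c : S) (x : K10A F R) (i : Fin 10) :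
    (c • x) i = c • (x i) := rfl

variable (F R)

def even (S : Type) [Semiring S] [Module S R] : Submodule S (K10A F R) :=
  stdSub S R 10 {0, 1, 2, 3, 4, 5}
def odd (S : Type) [Semiring S] [Module S R] : Submodule S (K10A F R) :=
  stdSub S R 10 {6, 7, 8, 9}

/-- The unity `1`. -/
def oneE : K10A F R := ![1, 0, 0, 0, 0, 0, 0, 0, 0, 0]
/-- The element `a ⊗ a`. -/
def aaE : K10A F R := ![0, 1, 0, 0, 0, 0, 0, 0, 0, 0]
/-- The element `v ⊗ w ∈ W ⊗ W`. -/
def wwE (w w' : Fin 2 → R) : K10A F R :=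
  ![0, 0, w 0 * w' 0, w 0 * w' 1, w 1 * w' 0, w 1 * w' 1, 0, 0, 0, 0]
/-- The element `w ⊗ a`, `w ∈ W ⊗ R`. -/
def waE (w : Fin 2 → R) : K10A F R := ![0, 0, 0, 0, 0, 0, w 0, w 1, 0, 0]
/-- The element `a ⊗ w`, `w ∈ W ⊗ R`. -/
def awE (w : Fin 2 → R) : K10A F R := ![0, 0, 0, 0, 0, 0, 0, 0, w 0, w 1]
/-- The exchange automorphism `τ`, `τ(x ⊗ y) = (-1)^{|x||y|} y ⊗ x`. -/
def tauFun (x : K10A F R) : K10A F R := fun i =>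
  match i with
  | ⟨0, _⟩ => x 0
  | ⟨1, _⟩ => x 1
  | ⟨2, _⟩ => -x 2
  | ⟨3, _⟩ => -x 4
  | ⟨4, _⟩ => -x 3
  | ⟨5, _⟩ => -x 5
  | ⟨6, _⟩ => x 8
  | ⟨7, _⟩ => x 9
  | ⟨8, _⟩ => x 6
  | ⟨9, _⟩ => x 7

end K10A

end Algebras

end Kac

namespace Kac

/-- `p` (a submodule of `B`, e.g. the even part) is isomorphic, as an
`F`-algebra, to `C`: there is an `F`-linear bijection preserving products. -/
def SubAlgIso (F B C : Type) [Field F] [NonUnitalNonAssocRing B] [Module F B]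
    [Ring C] [Algebra F C] (p : Submodule F B) : Prop :=
  ∃ e : p ≃ₗ[F] C, ∀ (x y : p) (h : (x : B) * (y : B) ∈ p),
    e ⟨(x : B) * (y : B), h⟩ = e x * e y

/-- A quadratic étale `F`-algebra: two-dimensional, and either isomorphic to
`F × F` or a (quadratic) separable field extension of `F`. -/
def IsQuadraticEtale (F K : Type) [Field F] [CommRing K] [Algebra F K] : Prop :=
  Module.finrank F K = 2 ∧
    (Nonempty (K ≃ₐ[F] (F × F)) ∨ (IsField K ∧ Algebra.IsSeparable F K))

end Kac

/-! ### Identities in `K₁₀` over a field -/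

namespace Kac.K10A

section Identities

variable {F L : Type} [Field F] [Field L] [Algebra F L]

/-- The alternating form on the summand `W ⊗ a` of the odd part. -/
def leftForm (x y : K10A F L) : L := x 6 * y 7 - x 7 * y 6

/-- The alternating form on the summand `a ⊗ W` of the odd part. -/
def rightForm (x y : K10A F L) : L := x 8 * y 9 - x 9 * y 8

/-- The component in `W ⊗ a`. -/
def leftPart (x : K10A F L) : K10A F L := ![0, 0, 0, 0, 0, 0, x 6, x 7, 0, 0]

/-- The component in `a ⊗ W`. -/
def rightPart (x : K10A F L) : K10A F L := ![0, 0, 0, 0, 0, 0, 0, 0, x 8, x 9]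

@[ext] lemma ext {x y : K10A F L} (h : ∀ i, x i = y i) : x = y := funext h

lemma nsmul_apply (n : ℕ) (x : K10A F L) (i : Fin 10) : (n • x) i = n * x i :=
  nsmul_eq_mul n (x i)

lemma mem_odd {S : Type} [Semiring S] [Module S L] {x : K10A F L} :
    x ∈ odd F L S ↔ x 0 = 0 ∧ x 1 = 0 ∧ x 2 = 0 ∧ x 3 = 0 ∧ x 4 = 0 ∧ x 5 = 0 := by
  change (∀ i : Fin 10, i ∉ ({6, 7, 8, 9} : Set (Fin 10)) → x i = 0) ↔ _
  simp [Fin.forall_fin_succ]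

lemma mem_even {S : Type} [Semiring S] [Module S L] {x : K10A F L} :
    x ∈ even F L S ↔ x 6 = 0 ∧ x 7 = 0 ∧ x 8 = 0 ∧ x 9 = 0 := by
  change (∀ i : Fin 10, i ∉ ({0, 1, 2, 3, 4, 5} : Set (Fin 10)) → x i = 0) ↔ _
  simp [Fin.forall_fin_succ]

section Coordinates

variable (x y : K10A F L)

lemma mul_zero_coord : (x * y) 0 = x 0 * y 0 - 3 / 16 * (x 1 * y 1)
    + 3 / 4 * (x 2 * y 5 + x 5 * y 2 - x 3 * y 4 - x 4 * y 3)
    - 3 / 8 * (leftForm x y + rightForm x y) := by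
  simp only [mul_def, mulFun, map_ofNat, map_div₀, leftForm, rightForm]; ring
lemma mul_one_coord : (x * y) 1 = x 0 * y 1 + x 1 * y 0 + x 1 * y 1
    - (x 2 * y 5 + x 5 * y 2 - x 3 * y 4 - x 4 * y 3)
    + (leftForm x y + rightForm x y) := by
  simp [mul_def, mulFun, leftForm, rightForm]; ring
lemma mul_two_coord : (x * y) 2 = x 0 * y 2 + x 2 * y 0
    + (x 1 * y 2 + x 2 * y 1) / 4 + (x 6 * y 8 - x 8 * y 6) / 4 := by
  simp [mul_def, mulFun, map_ofNat]; ring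
lemma mul_three_coord : (x * y) 3 = x 0 * y 3 + x 3 * y 0
    + (x 1 * y 3 + x 3 * y 1) / 4 + (x 6 * y 9 - x 9 * y 6) / 4 := by
  simp [mul_def, mulFun, map_ofNat]; ring
lemma mul_four_coord : (x * y) 4 = x 0 * y 4 + x 4 * y 0
    + (x 1 * y 4 + x 4 * y 1) / 4 + (x 7 * y 8 - x 8 * y 7) / 4 := by
  simp [mul_def, mulFun, map_ofNat]; ring
lemma mul_five_coord : (x * y) 5 = x 0 * y 5 + x 5 * y 0
    + (x 1 * y 5 + x 5 * y 1) / 4 + (x 7 * y 9 - x 9 * y 7) / 4 := by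
  simp [mul_def, mulFun, map_ofNat]; ring
lemma mul_six_coord : (x * y) 6 = x 0 * y 6 + x 6 * y 0 + (x 1 * y 6 + x 6 * y 1) / 2
    + (x 2 * y 9 + x 9 * y 2) / 2 - (x 3 * y 8 + x 8 * y 3) / 2 := by
  simp [mul_def, mulFun, map_ofNat]; ring
lemma mul_seven_coord : (x * y) 7 = x 0 * y 7 + x 7 * y 0 + (x 1 * y 7 + x 7 * y 1) / 2
    + (x 4 * y 9 + x 9 * y 4) / 2 - (x 5 * y 8 + x 8 * y 5) / 2 := by
  simp [mul_def, mulFun, map_ofNat]; ring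
lemma mul_eight_coord : (x * y) 8 = x 0 * y 8 + x 8 * y 0 + (x 1 * y 8 + x 8 * y 1) / 2
    - (x 2 * y 7 + x 7 * y 2) / 2 + (x 4 * y 6 + x 6 * y 4) / 2 := by
  simp [mul_def, mulFun, map_ofNat]; ring
lemma mul_nine_coord : (x * y) 9 = x 0 * y 9 + x 9 * y 0 + (x 1 * y 9 + x 9 * y 1) / 2
    - (x 3 * y 7 + x 7 * y 3) / 2 + (x 5 * y 6 + x 6 * y 5) / 2 := by
  simp [mul_def, mulFun, map_ofNat]; ring

lemma leftPart_apply (i : Fin 10) :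
    leftPart x i = (![0, 0, 0, 0, 0, 0, x 6, x 7, 0, 0] : Fin 10 → L) i := rfl
lemma rightPart_apply (i : Fin 10) :
    rightPart x i = (![0, 0, 0, 0, 0, 0, 0, 0, x 8, x 9] : Fin 10 → L) i := rfl

end Coordinates

lemma leftPart_add_rightPart {x : K10A F L} (hx : x ∈ odd F L L) :
    leftPart x + rightPart x = x := by
  obtain ⟨h0, h1, h2, h3, h4, h5⟩ := mem_odd.1 hx
  ext i
  fin_cases i <;> simp [leftPart_apply, rightPart_apply, *]

/-- Triple products of odd elements. -/
lemma eight_nsmul_mul_mul (hL : (2 : L) ≠ 0) {x y z : K10A F L} (hx : x ∈ odd F L L)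
    (hy : y ∈ odd F L L) (hz : z ∈ odd F L L) :
    8 • (x * y * z) = (leftForm x y + rightForm x y) • z - rightForm z y • leftPart x
      + rightForm z x • leftPart y + leftForm z x • rightPart y
      - leftForm z y • rightPart x := by
  obtain ⟨x0, x1, x2, x3, x4, x5⟩ := mem_odd.1 hx
  obtain ⟨y0, y1, y2, y3, y4, y5⟩ := mem_odd.1 hy
  obtain ⟨z0, z1, z2, z3, z4, z5⟩ := mem_odd.1 hz
  have h4 : (4 : L) ≠ 0 := by
    rw [show (4 : L) = 2 * 2 by norm_num]; exact mul_ne_zero hL hL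
  have h8 : (8 : L) ≠ 0 := by
    rw [show (8 : L) = 2 * 4 by norm_num]; exact mul_ne_zero hL h4
  ext i
  fin_cases i <;>
    simp [nsmul_apply, leftPart_apply, rightPart_apply, leftForm, rightForm,
      mul_zero_coord, mul_one_coord, mul_two_coord, mul_three_coord, mul_four_coord,
      mul_five_coord, mul_six_coord, mul_seven_coord, mul_eight_coord, mul_nine_coord, *] <;>
    field_simp <;> ring

/-- The linear map given by the tensor action of two `2 × 2` matrices with columns `(g₀, g₁)`,
`(g₂, g₃)` and `(h₀, h₁)`, `(h₂, h₃)`. -/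
def actFun (g h : Fin 4 → L) (x : K10A F L) : K10A F L :=
  ![x 0, x 1,
    g 0 * h 0 * x 2 + g 0 * h 2 * x 3 + g 2 * h 0 * x 4 + g 2 * h 2 * x 5,
    g 0 * h 1 * x 2 + g 0 * h 3 * x 3 + g 2 * h 1 * x 4 + g 2 * h 3 * x 5,
    g 1 * h 0 * x 2 + g 1 * h 2 * x 3 + g 3 * h 0 * x 4 + g 3 * h 2 * x 5,
    g 1 * h 1 * x 2 + g 1 * h 3 * x 3 + g 3 * h 1 * x 4 + g 3 * h 3 * x 5,
    g 0 * x 6 + g 2 * x 7, g 1 * x 6 + g 3 * x 7,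
    h 0 * x 8 + h 2 * x 9, h 1 * x 8 + h 3 * x 9]

lemma actFun_apply (g h : Fin 4 → L) (x : K10A F L) (i : Fin 10) :
    actFun g h x i = (![x 0, x 1,
      g 0 * h 0 * x 2 + g 0 * h 2 * x 3 + g 2 * h 0 * x 4 + g 2 * h 2 * x 5,
      g 0 * h 1 * x 2 + g 0 * h 3 * x 3 + g 2 * h 1 * x 4 + g 2 * h 3 * x 5,
      g 1 * h 0 * x 2 + g 1 * h 2 * x 3 + g 3 * h 0 * x 4 + g 3 * h 2 * x 5,
      g 1 * h 1 * x 2 + g 1 * h 3 * x 3 + g 3 * h 1 * x 4 + g 3 * h 3 * x 5,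
      g 0 * x 6 + g 2 * x 7, g 1 * x 6 + g 3 * x 7,
      h 0 * x 8 + h 2 * x 9, h 1 * x 8 + h 3 * x 9] : Fin 10 → L) i := rfl

lemma actFun_mul {g h : Fin 4 → L} (hg : g 0 * g 3 - g 1 * g 2 = 1)
    (hh : h 0 * h 3 - h 1 * h 2 = 1) (x y : K10A F L) :
    actFun g h (x * y) = actFun g h x * actFun g h y := by
  have hll : leftForm (actFun g h x) (actFun g h y) = leftForm x y := by
    simp only [leftForm, actFun_apply, Matrix.cons_val]
    linear_combination (x 6 * y 7 - x 7 * y 6) * hg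
  have hrr : rightForm (actFun g h x) (actFun g h y) = rightForm x y := by
    simp only [rightForm, actFun_apply, Matrix.cons_val]
    linear_combination (x 8 * y 9 - x 9 * y 8) * hh
  set D := x 2 * y 5 + x 5 * y 2 - x 3 * y 4 - x 4 * y 3 with hD
  have hww : actFun g h x 2 * actFun g h y 5 + actFun g h x 5 * actFun g h y 2
      - actFun g h x 3 * actFun g h y 4 - actFun g h x 4 * actFun g h y 3 = D := by
    simp only [hD, actFun_apply, Matrix.cons_val]
    linear_combination D * ((g 0 * g 3 - g 1 * g 2) * hh + hg)
  ext i
  fin_cases i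
  · simp only [Fin.reduceFinMk, mul_zero_coord, hll, hrr, hww]
    simp [actFun_apply, mul_zero_coord, hD]
  · simp only [Fin.reduceFinMk, mul_one_coord, hll, hrr, hww]
    simp [actFun_apply, mul_one_coord, hD]
  · simp [actFun_apply, mul_two_coord, mul_three_coord, mul_four_coord, mul_five_coord]; ring
  · simp [actFun_apply, mul_two_coord, mul_three_coord, mul_four_coord, mul_five_coord]; ring
  · simp [actFun_apply, mul_two_coord, mul_three_coord, mul_four_coord, mul_five_coord]; ring
  · simp [actFun_apply, mul_two_coord, mul_three_coord, mul_four_coord, mul_five_coord]; ring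
  · simp [actFun_apply, mul_six_coord, mul_seven_coord]
    linear_combination (-1 / 2 * (g 0 * (x 2 * y 9 + x 9 * y 2 - x 3 * y 8 - x 8 * y 3)
      + g 2 * (x 4 * y 9 + x 9 * y 4 - x 5 * y 8 - x 8 * y 5))) * hh
  · simp [actFun_apply, mul_six_coord, mul_seven_coord]
    linear_combination (-1 / 2 * (g 1 * (x 2 * y 9 + x 9 * y 2 - x 3 * y 8 - x 8 * y 3)
      + g 3 * (x 4 * y 9 + x 9 * y 4 - x 5 * y 8 - x 8 * y 5))) * hh
  · simp [actFun_apply, mul_eight_coord, mul_nine_coord]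
    linear_combination (-1 / 2 * (h 0 * (x 4 * y 6 + x 6 * y 4 - x 2 * y 7 - x 7 * y 2)
      + h 2 * (x 5 * y 6 + x 6 * y 5 - x 3 * y 7 - x 7 * y 3))) * hg
  · simp [actFun_apply, mul_eight_coord, mul_nine_coord]
    linear_combination (-1 / 2 * (h 1 * (x 4 * y 6 + x 6 * y 4 - x 2 * y 7 - x 7 * y 2)
      + h 3 * (x 5 * y 6 + x 6 * y 5 - x 3 * y 7 - x 7 * y 3))) * hg

/-- The inverse (adjugate) of a `2 × 2` matrix of determinant one, stored by columns. -/
def adj (g : Fin 4 → L) : Fin 4 → L := ![g 3, -g 1, -g 2, g 0]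

lemma actFun_adj {g h : Fin 4 → L} (hg : g 0 * g 3 - g 1 * g 2 = 1)
    (hh : h 0 * h 3 - h 1 * h 2 = 1) (x : K10A F L) :
    actFun (adj g) (adj h) (actFun g h x) = x := by
  have hgh : (g 0 * g 3 - g 1 * g 2) * (h 0 * h 3 - h 1 * h 2) = 1 := by simp [hg, hh]
  ext i
  fin_cases i <;> simp [actFun_apply, adj]
  · linear_combination x 2 * hgh
  · linear_combination x 3 * hgh
  · linear_combination x 4 * hgh
  · linear_combination x 5 * hgh
  · linear_combination x 6 * hg
  · linear_combination x 7 * hg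
  · linear_combination x 8 * hh
  · linear_combination x 9 * hh

/-- The action of a pair of `2 × 2` matrices of determinant one. -/
def act (g h : Fin 4 → L) (hg : g 0 * g 3 - g 1 * g 2 = 1)
    (hh : h 0 * h 3 - h 1 * h 2 = 1) : K10A F L ≃ₗ[L] K10A F L where
  toFun := actFun g h
  invFun := actFun (adj g) (adj h)
  map_add' x y := by
    ext i
    fin_cases i <;> simp [actFun_apply] <;> ring
  map_smul' c x := by
    ext i
    fin_cases i <;> simp [actFun_apply] <;> ring
  left_inv := actFun_adj hg hh
  right_inv x := by
    have hadj : ∀ k : Fin 4 → L, adj (adj k) = k := fun k => by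
      ext i
      fin_cases i <;> simp [adj]
    have := actFun_adj (F := F) (g := adj g) (h := adj h)
      (by simp [adj]; linear_combination hg) (by simp [adj]; linear_combination hh) x
    rwa [hadj, hadj] at this

/-- The exchange automorphism as a linear equivalence. -/
def tau : K10A F L ≃ₗ[L] K10A F L where
  toFun := tauFun F L
  invFun := tauFun F L
  map_add' x y := by
    ext i
    fin_cases i <;> simp [tauFun, add_comm]
  map_smul' c x := by
    ext i
    fin_cases i <;> simp [tauFun]
  left_inv x := by
    ext i
    fin_cases i <;> simp [tauFun]
  right_inv x := by
    ext i
    fin_cases i <;> simp [tauFun]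

lemma tau_mul (x y : K10A F L) : tau (x * y) = tau x * tau y := by
  ext i
  fin_cases i <;> simp [tau, tauFun, mul_def, mulFun] <;> ring

end Identities

section Subforms

variable {F K L : Type} [Field F] [Field K] [Field L] [Algebra F L] [Algebra K L]

instance : IsScalarTower K L (K10A F L) := inferInstanceAs (IsScalarTower K L (Fin 10 → L))

lemma leftPart_mem_odd (x : K10A F L) : leftPart x ∈ odd F L L := by
  simp [mem_odd, leftPart_apply]

lemma rightPart_mem_odd (x : K10A F L) : rightPart x ∈ odd F L L := by
  simp [mem_odd, rightPart_apply]

lemma eight_nsmul_mul_self_left (hL : (2 : L) ≠ 0) {x y : K10A F L} (hx : x ∈ odd F L L)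
    (hy : y ∈ odd F L L) :
    8 • (x * y * x) = leftForm x y • leftPart x + rightForm x y • rightPart x := by
  have h₁ : leftForm x x = 0 := by simp [leftForm, mul_comm]
  have h₂ : rightForm x x = 0 := by simp [rightForm, mul_comm]
  rw [eight_nsmul_mul_mul hL hx hy hx, h₁, h₂]
  nth_rewrite 3 [← leftPart_add_rightPart hx]
  module

lemma eight_nsmul_mul_self_right (hL : (2 : L) ≠ 0) {x y : K10A F L} (hx : x ∈ odd F L L)
    (hy : y ∈ odd F L L) :
    8 • (x * y * y) = leftForm x y • leftPart y + rightForm x y • rightPart y := by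
  have h₁ : leftForm y y = 0 := by simp [leftForm, mul_comm]
  have h₂ : rightForm y y = 0 := by simp [rightForm, mul_comm]
  have h₃ : leftForm y x = -leftForm x y := by simp [leftForm]; ring
  have h₄ : rightForm y x = -rightForm x y := by simp [rightForm]; ring
  rw [eight_nsmul_mul_mul hL hx hy hy, h₁, h₂, h₃, h₄]
  nth_rewrite 3 [← leftPart_add_rightPart hy]
  module

lemma leftForm_rightPart (x y : K10A F L) : leftForm x (rightPart y) = 0 := by
  simp [leftForm, rightPart_apply]

lemma rightForm_leftPart (x y : K10A F L) : rightForm (leftPart x) y = 0 := by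
  simp [rightForm, leftPart_apply]

lemma rightForm_leftPart' (x y : K10A F L) : rightForm x (leftPart y) = 0 := by
  simp [rightForm, leftPart_apply]

lemma leftForm_leftPart (x y : K10A F L) :
    leftForm (leftPart x) (leftPart y) = leftForm x y := by
  simp [leftForm, leftPart_apply]

lemma rightForm_rightPart (x y : K10A F L) :
    rightForm (rightPart x) (rightPart y) = rightForm x y := by
  simp [rightForm, rightPart_apply]

lemma leftPart_rightPart (x : K10A F L) : leftPart (rightPart x) = 0 := by
  ext i; fin_cases i <;> simp [leftPart_apply, rightPart_apply]

lemma rightPart_leftPart (x : K10A F L) : rightPart (leftPart x) = 0 := by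
  ext i; fin_cases i <;> simp [leftPart_apply, rightPart_apply]

lemma eight_nsmul_left_mul_left_mul_right (hL : (2 : L) ≠ 0) (x y z : K10A F L) :
    8 • (leftPart x * leftPart y * rightPart z) = leftForm x y • rightPart z := by
  rw [eight_nsmul_mul_mul hL (leftPart_mem_odd x) (leftPart_mem_odd y) (rightPart_mem_odd z)]
  simp [leftForm_leftPart, rightForm_leftPart', rightPart_leftPart]

lemma eight_nsmul_right_mul_right_mul_left (hL : (2 : L) ≠ 0) (x y z : K10A F L) :
    8 • (rightPart x * rightPart y * leftPart z) = rightForm x y • leftPart z := by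
  rw [eight_nsmul_mul_mul hL (rightPart_mem_odd x) (rightPart_mem_odd y) (leftPart_mem_odd z)]
  simp [rightForm_rightPart, leftForm_rightPart, leftPart_rightPart]

lemma eight_nsmul_mul_left_mul_left (hL : (2 : L) ≠ 0) {u v z : K10A F L}
    (hz : z ∈ odd F L L) (huv : leftForm u v = 1) :
    8 • (z * leftPart v * leftPart u) = leftForm z v • leftPart u - rightPart z := by
  rw [eight_nsmul_mul_mul hL hz (leftPart_mem_odd v) (leftPart_mem_odd u)]
  have : leftForm z (leftPart v) = leftForm z v := by simp [leftForm, leftPart_apply]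
  simp [leftForm_leftPart, rightForm_leftPart, rightForm_leftPart', rightPart_leftPart, this, huv]

/-- A subring-like `K`-subspace containing a symplectic pair of `W ⊗ a` is stable under
projection of odd elements to `a ⊗ W`. -/
lemma rightPart_mem (hL : (2 : L) ≠ 0) {R : Submodule K (K10A F L)}
    (hR : ∀ x ∈ R, ∀ y ∈ R, x * y ∈ R) {u v z : K10A F L} (hu : leftPart u ∈ R)
    (hv : leftPart v ∈ R) (huv : leftForm u v = 1) (hz : z ∈ odd F L L) (hzR : z ∈ R) :
    rightPart z ∈ R := by
  set z' := leftForm z v • leftPart u - rightPart z with hz'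
  have h₁ : z' ∈ R := by
    rw [hz', ← eight_nsmul_mul_left_mul_left hL hz huv]
    exact R.nsmul_mem (hR _ (hR _ hzR _ hv) _ hu) 8
  have hodd : z' ∈ odd F L L :=
    sub_mem (Submodule.smul_mem _ _ (leftPart_mem_odd u)) (rightPart_mem_odd z)
  have h₂ : leftForm z' v • leftPart u - rightPart z' ∈ R := by
    rw [← eight_nsmul_mul_left_mul_left hL hodd huv]
    exact R.nsmul_mem (hR _ (hR _ h₁ _ hv) _ hu) 8
  have h₃ : leftForm z' v = leftForm z v := by
    have : leftForm z' v = leftForm z v * leftForm u v := by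
      simp [leftForm, hz', leftPart_apply, rightPart_apply]; ring
    rw [this, huv, mul_one]
  have h₄ : rightPart z' = -rightPart z := by
    ext i
    fin_cases i <;> simp [hz', leftPart_apply, rightPart_apply]
  have hK : (2 : K) ≠ 0 := fun h => hL <| by
    rw [← map_ofNat (algebraMap K L) 2, h, map_zero]
  have h₅ : rightPart z = (2 : K)⁻¹ • (leftForm z' v • leftPart u - rightPart z' - z') := by
    rw [h₃, h₄, hz', eq_inv_smul_iff₀ hK, ofNat_smul_eq_nsmul]
    module
  rw [h₅]
  exact R.smul_mem _ (R.sub_mem h₂ h₁)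

/-- The standard basis vectors. -/
def std (F : Type) {L : Type} [Field F] [Field L] [Algebra F L] (i : Fin 10) : K10A F L :=
  fun j => if j = i then 1 else 0

lemma std_apply (i j : Fin 10) : std F (L := L) i j = if j = i then 1 else 0 := rfl

lemma leftPart_std_six : leftPart (std F (L := L) 6) = std F 6 := by
  ext i; fin_cases i <;> simp [leftPart_apply, std_apply]
lemma leftPart_std_seven : leftPart (std F (L := L) 7) = std F 7 := by
  ext i; fin_cases i <;> simp [leftPart_apply, std_apply]
lemma rightPart_std_eight : rightPart (std F (L := L) 8) = std F 8 := by
  ext i; fin_cases i <;> simp [rightPart_apply, std_apply]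
lemma rightPart_std_nine : rightPart (std F (L := L) 9) = std F 9 := by
  ext i; fin_cases i <;> simp [rightPart_apply, std_apply]

/-- A graded `K`-form of `K₁₀ ⊗ L` containing the standard odd basis is the standard one. -/
lemma coord_mem_fieldRange (hL : (2 : L) ≠ 0) {R : Submodule K (K10A F L)}
    (hR : ∀ x ∈ R, ∀ y ∈ R, x * y ∈ R)
    (hscal : ∀ x ∈ R, x ≠ 0 → ∀ c : L, c • x ∈ R → c ∈ (algebraMap K L).fieldRange)
    (hgr : ∀ x ∈ R, ∃ y ∈ R, ∃ z ∈ R, y ∈ even F L L ∧ z ∈ odd F L L ∧ x = y + z)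
    (h6 : std F 6 ∈ R) (h7 : std F 7 ∈ R) (h8 : std F 8 ∈ R) (h9 : std F 9 ∈ R)
    {x : K10A F L} (hx : x ∈ R) (i : Fin 10) : x i ∈ (algebraMap K L).fieldRange := by
  set k := (algebraMap K L).fieldRange
  have hne : ∀ i, std F (L := L) i ≠ 0 := fun i h => by
    simpa [std_apply] using congrFun h i
  have hodd : ∀ z ∈ R, z ∈ odd F L L → ∀ i, z i ∈ k := by
    intro z hz hzo
    have hr : rightPart z ∈ R := rightPart_mem hL hR (u := std F 6) (v := std F 7)
      (by rwa [leftPart_std_six]) (by rwa [leftPart_std_seven])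
      (by simp [leftForm, std_apply]) hzo hz
    have hl : leftPart z ∈ R := by
      rw [← add_sub_cancel_right (leftPart z) (rightPart z), leftPart_add_rightPart hzo]
      exact R.sub_mem hz hr
    have key₁ : ∀ y, leftPart y ∈ R → leftForm z y ∈ k := fun y hy => by
      refine hscal _ h8 (hne 8) _ ?_
      rw [← rightPart_std_eight, ← eight_nsmul_left_mul_left_mul_right hL, rightPart_std_eight]
      exact R.nsmul_mem (hR _ (hR _ hl _ hy) _ h8) 8
    have key₂ : ∀ y, rightPart y ∈ R → rightForm z y ∈ k := fun y hy => by
      refine hscal _ h6 (hne 6) _ ?_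
      rw [← leftPart_std_six, ← eight_nsmul_right_mul_right_mul_left hL, leftPart_std_six]
      exact R.nsmul_mem (hR _ (hR _ hr _ hy) _ h6) 8
    have z6 := key₁ (std F 7) (by rwa [leftPart_std_seven])
    have z7 := key₁ (std F 6) (by rwa [leftPart_std_six])
    have z8 := key₂ (std F 9) (by rwa [rightPart_std_nine])
    have z9 := key₂ (std F 8) (by rwa [rightPart_std_eight])
    simp [leftForm, rightForm, std_apply] at z6 z7 z8 z9
    obtain ⟨z0, z1, z2, z3, z4, z5⟩ := mem_odd.1 hzo
    intro i
    fin_cases i <;> simp [*, k.zero_mem]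
  have heven : ∀ y ∈ R, y ∈ even F L L → ∀ i, y i ∈ k := by
    intro y hy hye
    obtain ⟨y6, y7, y8, y9⟩ := mem_even.1 hye
    have hcoord := fun j => hodd (y * std F 6) (hR _ hy _ h6)
      (by simp [mem_odd, mul_zero_coord, mul_one_coord, mul_two_coord, mul_three_coord,
            mul_four_coord, mul_five_coord, leftForm, rightForm, std_apply, *]) j
    have hcoord' := fun j => hodd (y * std F 7) (hR _ hy _ h7)
      (by simp [mem_odd, mul_zero_coord, mul_one_coord, mul_two_coord, mul_three_coord,
            mul_four_coord, mul_five_coord, leftForm, rightForm, std_apply, *]) j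
    have hcoord'' := hodd (y * (std F 6 * std F 8) * std F 7)
      (hR _ (hR _ hy _ (hR _ h6 _ h8)) _ h7)
      (by simp [mem_odd, mul_zero_coord, mul_one_coord, mul_two_coord, mul_three_coord,
            mul_four_coord, mul_five_coord, mul_six_coord, mul_seven_coord, mul_eight_coord,
            mul_nine_coord, leftForm, rightForm, std_apply, *]) 8
    have h2k : (2 : L) ∈ k := ofNat_mem k 2
    have h4 : (4 : L) ≠ 0 := by
      rw [show (4 : L) = 2 * 2 by norm_num]; exact mul_ne_zero hL hL
    have c6 := hcoord 6
    have c8 := k.mul_mem (hcoord 8) h2k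
    have c9 := k.mul_mem (hcoord 9) h2k
    have c8' := k.mul_mem (hcoord' 8) h2k
    have c9' := k.mul_mem (hcoord' 9) h2k
    simp [mul_zero_coord, mul_one_coord, mul_two_coord, mul_three_coord,
            mul_four_coord, mul_five_coord, mul_six_coord, mul_seven_coord, mul_eight_coord,
            mul_nine_coord, leftForm, rightForm, std_apply, hL, y6, y7, y8, y9]
            at c6 c8 c9 c8' c9' hcoord''
    have d : y 0 + y 1 / 4 ∈ k := by
      convert k.mul_mem hcoord'' (ofNat_mem k 8) using 1
      field_simp
      ring
    have y1 : y 1 ∈ k := by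
      convert k.mul_mem (k.sub_mem c6 d) (ofNat_mem k 4) using 1
      field_simp
      ring
    have y0 : y 0 ∈ k := by
      simpa using k.sub_mem c6 (k.div_mem y1 h2k)
    intro i
    fin_cases i <;> simp [*, k.zero_mem]
  obtain ⟨y, hy, z, hz, hye, hzo, rfl⟩ := hgr x hx
  exact k.add_mem (heven y hy hye i) (hodd z hz hzo i)

end Subforms

end Kac.K10A

namespace Kac

section Descent

variable {K L X V ι : Type} [Field K] [Field L] [Algebra K L] [AddCommGroup X] [Module K X]
  [AddCommGroup V] [Module K V] [Module L V] [IsScalarTower K L V]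
  {ψ : X →ₗ[K] V} {bX : Module.Basis ι K X} {bV : Module.Basis ι L V}

/-- Functionals extend along a `K`-form `ψ : X → V` of an `L`-vector space. -/
lemma exists_functional_extending (hb : ∀ i, ψ (bX i) = bV i) (f : X →ₗ[K] K) :
    ∃ g : V →ₗ[L] L, ∀ x, g (ψ x) = algebraMap K L (f x) := by
  refine ⟨bV.constr L fun i => algebraMap K L (f (bX i)), fun x => ?_⟩
  have : (bV.constr L fun i => algebraMap K L (f (bX i))).restrictScalars K ∘ₗ ψ
      = Algebra.linearMap K L ∘ₗ f := by
    refine bX.ext fun i => ?_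
    simp only [LinearMap.comp_apply, LinearMap.restrictScalars_apply, hb,
      Module.Basis.constr_basis, Algebra.linearMap_apply]
  exact LinearMap.congr_fun this x

lemma injective_of_form (hb : ∀ i, ψ (bX i) = bV i) : Function.Injective ψ := by
  rw [injective_iff_map_eq_zero]
  intro x hx
  refine (Module.forall_dual_apply_eq_zero_iff K x).1 fun f => ?_
  obtain ⟨g, hg⟩ := exists_functional_extending hb f
  have := hg x
  rw [hx, map_zero] at this
  exact (map_eq_zero (algebraMap K L)).1 this.symm

lemma scalar_descends (hb : ∀ i, ψ (bX i) = bV i) {x y : X} {c : L} (hx : x ≠ 0)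
    (h : c • ψ x = ψ y) : ∃ k : K, algebraMap K L k = c := by
  obtain ⟨f, hf⟩ : ∃ f : Module.Dual K X, f x ≠ 0 := by
    by_contra! hall
    exact hx ((Module.forall_dual_apply_eq_zero_iff K x).1 hall)
  obtain ⟨g, hg⟩ := exists_functional_extending hb f
  have h₁ := congrArg g h
  rw [map_smul, hg, hg, smul_eq_mul] at h₁
  refine ⟨f y / f x, ?_⟩
  rw [map_div₀, div_eq_iff ((map_ne_zero _).2 hf), h₁]

lemma pair_descends (hb : ∀ i, ψ (bX i) = bV i) {x x' y : X} {c c' : L} (hx : x ≠ 0)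
    (hx' : ∀ k : K, x' ≠ k • x) (h : c • ψ x + c' • ψ x' = ψ y) :
    (∃ k : K, algebraMap K L k = c) ∧ ∃ k : K, algebraMap K L k = c' := by
  have hmem : x' ∉ Submodule.span K {x} := fun hm => by
    obtain ⟨k, hk⟩ := Submodule.mem_span_singleton.1 hm
    exact hx' k hk.symm
  obtain ⟨f, hf, hker⟩ := Submodule.exists_le_ker_of_notMem hmem
  have hfx : f x = 0 := hker (Submodule.mem_span_singleton_self x)
  obtain ⟨g, hg⟩ := exists_functional_extending hb f
  have h₁ := congrArg g h
  rw [map_add, map_smul, map_smul, hg, hg, hg, hfx, map_zero, smul_zero, zero_add,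
    smul_eq_mul] at h₁
  have hc' : algebraMap K L (f y / f x') = c' := by
    rw [map_div₀, div_eq_iff ((map_ne_zero _).2 hf), h₁]
  refine ⟨scalar_descends hb (y := y - (f y / f x') • x') hx ?_, _, hc'⟩
  rw [map_sub, map_smul, ← algebraMap_smul L (f y / f x'), hc', ← h, add_sub_cancel_right]

end Descent

namespace K10A

section Forms

variable {F K L X ι : Type} [Field F] [Field K] [Field L] [Algebra F K] [Algebra F L]
  [Algebra K L] [AddCommGroup X] [Module K X] [Mul X]
  {evX odX : Submodule K X} {ψ : X →ₗ[K] K10A F L}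
  {bX : Module.Basis ι K X} {bL : Module.Basis ι L (K10A F L)}

lemma finrank_eq_ten : Module.finrank L (K10A F L) = 10 := by
  change Module.finrank L (Fin 10 → L) = 10
  simp

/-- Extension of scalars on coordinates. -/
def extend (F : Type) {K L : Type} [Field F] [Field K] [Field L] [Algebra F K] [Algebra F L]
    [Algebra K L] (x : K10A F K) : K10A F L :=
  fun i => algebraMap K L (x i)

lemma extend_mul (x y : K10A F K) :
    (extend F (x * y) : K10A F L) = extend F x * extend F y := by
  ext i
  fin_cases i <;>
    simp [extend, mul_def, mulFun, map_ofNat]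

lemma nonempty_superIso_of_coord (hinj : Function.Injective ψ)
    (hmul : ∀ x y, ψ (x * y) = ψ x * ψ y) (hev : ∀ x ∈ evX, ψ x ∈ even F L L)
    (hod : ∀ x ∈ odX, ψ x ∈ odd F L L) (hsup : evX ⊔ odX = ⊤)
    (hfr : Module.finrank K X = 10)
    (hcoord : ∀ x i, ψ x i ∈ (algebraMap K L).fieldRange) :
    Nonempty (SuperIso K X (K10A F K) evX odX (even F K K) (odd F K K)) := by
  choose c hc using hcoord
  have ainj : Function.Injective (algebraMap K L) := (algebraMap K L).injective
  let e₀ : X →ₗ[K] K10A F K :=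
    { toFun := fun x i => c x i
      map_add' := fun x y => by
        ext i
        change c (x + y) i = c x i + c y i
        apply ainj
        simp [hc]
      map_smul' := fun k x => by
        ext i
        change c (k • x) i = k * c x i
        apply ainj
        simp [hc, Algebra.smul_def] }
  have he₀ : ∀ x, extend F (e₀ x) = ψ x := fun x => funext fun i => hc x i
  have hext : Function.Injective (extend F : K10A F K → K10A F L) := fun x y h =>
    funext fun i => ainj (congrFun h i)
  have hinj₀ : Function.Injective e₀ := fun x y h => hinj (by rw [← he₀, ← he₀, h])
  have : FiniteDimensional K X := Module.finite_of_finrank_pos (by omega)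
  have : FiniteDimensional K (K10A F K) :=
    Module.finite_of_finrank_pos (by rw [finrank_eq_ten]; omega)
  let e : X ≃ₗ[K] K10A F K :=
    e₀.linearEquivOfInjective hinj₀ (hfr.trans finrank_eq_ten.symm)
  have he : ∀ x, extend F (e x) = ψ x := he₀
  have e_even : ∀ x ∈ evX, e x ∈ even F K K := fun x hx => by
    have := hev x hx
    rw [← he, mem_even] at this
    simpa [extend, mem_even] using this
  have e_odd : ∀ x ∈ odX, e x ∈ odd F K K := fun x hx => by
    have := hod x hx
    rw [← he, mem_odd] at this
    simpa [extend, mem_odd] using this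
  have hdisj : ∀ z : K10A F K, z ∈ even F K K → z ∈ odd F K K → z = 0 := fun z h₁ h₂ => by
    obtain ⟨z6, z7, z8, z9⟩ := mem_even.1 h₁
    obtain ⟨z0, z1, z2, z3, z4, z5⟩ := mem_odd.1 h₂
    ext i
    fin_cases i <;> simp [*]
  have hsplit : ∀ z : K10A F K, ∃ x ∈ evX, ∃ y ∈ odX, e x + e y = z := fun z => by
    have : e.symm z ∈ evX ⊔ odX := hsup ▸ Submodule.mem_top
    obtain ⟨x, hx, y, hy, hxy⟩ := Submodule.mem_sup.1 this
    exact ⟨x, hx, y, hy, by rw [← map_add, hxy, e.apply_symm_apply]⟩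
  refine ⟨⟨e, fun x y => hext ?_, le_antisymm ?_ fun z hz => ?_, le_antisymm ?_ fun z hz => ?_⟩⟩
  · rw [extend_mul, he, he, he, hmul]
  · rintro _ ⟨x, hx, rfl⟩
    exact e_even x hx
  · obtain ⟨x, hx, y, hy, rfl⟩ := hsplit z
    have : e y = 0 := hdisj _
      (by simpa using Submodule.sub_mem _ hz (e_even x hx)) (e_odd y hy)
    exact ⟨x, hx, by simp [this]⟩
  · rintro _ ⟨x, hx, rfl⟩
    exact e_odd x hx
  · obtain ⟨x, hx, y, hy, rfl⟩ := hsplit z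
    have : e x = 0 := hdisj _ (e_even x hx)
      (by simpa using Submodule.sub_mem _ hz (e_odd y hy))
    exact ⟨y, hy, by simp [this]⟩

/-- A linear combination of the two alternating forms, as a bilinear form. -/
def pairing (F : Type) {L : Type} [Field F] [Field L] [Algebra F L] (c d : L) :
    LinearMap.BilinForm L (K10A F L) :=
  LinearMap.mk₂ L (fun x y => c * leftForm x y + d * rightForm x y)
    (fun x x' y => by simp [leftForm, rightForm]; ring)
    (fun k x y => by simp [leftForm, rightForm]; ring)
    (fun x y y' => by simp [leftForm, rightForm]; ring)
    (fun k x y => by simp [leftForm, rightForm]; ring)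

omit [Algebra F K] [Mul X] in
lemma exists_pairing_ne_zero (hb : ∀ i, ψ (bX i) = bL i) (hev : ∀ x ∈ evX, ψ x ∈ even F L L)
    (hsup : evX ⊔ odX = ⊤) {c d : L} (hcd : c ≠ 0 ∨ d ≠ 0) :
    ∃ x ∈ odX, ∃ y ∈ odX, c * leftForm (ψ x) (ψ y) + d * rightForm (ψ x) (ψ y) ≠ 0 := by
  by_contra! hzero
  have h₀ : pairing F c d = 0 := by
    refine bL.ext fun i => bL.ext fun j => ?_
    rw [← hb, ← hb]
    obtain ⟨x, hx, x', hx', hxx⟩ :=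
      Submodule.mem_sup.1 (hsup ▸ Submodule.mem_top : bX i ∈ evX ⊔ odX)
    obtain ⟨y, hy, y', hy', hyy⟩ :=
      Submodule.mem_sup.1 (hsup ▸ Submodule.mem_top : bX j ∈ evX ⊔ odX)
    obtain ⟨x6, x7, x8, x9⟩ := mem_even.1 (hev x hx)
    obtain ⟨y6, y7, y8, y9⟩ := mem_even.1 (hev y hy)
    rw [← hxx, ← hyy]
    clear hxx hyy
    have := hzero x' hx' y' hy'
    simpa [pairing, leftForm, rightForm, *] using this
  rcases hcd with h | h
  · apply h
    simpa [pairing, leftForm, rightForm, std_apply] using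
      LinearMap.congr_fun (LinearMap.congr_fun h₀ (std F 6)) (std F 7)
  · apply h
    simpa [pairing, leftForm, rightForm, std_apply] using
      LinearMap.congr_fun (LinearMap.congr_fun h₀ (std F 8)) (std F 9)

end Forms

end K10A

end Kac

namespace Kac.K10A

section Core

variable {F K L X ι : Type} [Field F] [Field K] [Field L] [Algebra F K] [Algebra F L]
  [Algebra K L] [AddCommGroup X] [Module K X] [Mul X]
  {evX odX : Submodule K X} {ψ : X →ₗ[K] K10A F L}
  {bX : Module.Basis ι K X} {bL : Module.Basis ι L (K10A F L)}


lemma act_apply {g h : Fin 4 → L} (hg : g 0 * g 3 - g 1 * g 2 = 1)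
    (hh : h 0 * h 3 - h 1 * h 2 = 1) (x : K10A F L) : act g h hg hh x = actFun g h x := rfl

lemma actFun_mem_even (g h : Fin 4 → L) {x : K10A F L} (hx : x ∈ even F L L) :
    actFun g h x ∈ even F L L := by
  obtain ⟨h6, h7, h8, h9⟩ := mem_even.1 hx
  simp [mem_even, actFun_apply, *]

lemma actFun_mem_odd (g h : Fin 4 → L) {x : K10A F L} (hx : x ∈ odd F L L) :
    actFun g h x ∈ odd F L L := by
  obtain ⟨h0, h1, h2, h3, h4, h5⟩ := mem_odd.1 hx
  simp [mem_odd, actFun_apply, *]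

omit [Algebra F K] in
lemma leftPart_mem (hL : (2 : L) ≠ 0) {R : Submodule K (K10A F L)}
    (hR : ∀ x ∈ R, ∀ y ∈ R, x * y ∈ R) {x y : K10A F L} (hx : x ∈ odd F L L)
    (hy : y ∈ odd F L L) (hxR : x ∈ R) (hyR : y ∈ R) {a b : K} (hab : a ≠ b)
    (hα : leftForm x y = algebraMap K L a) (hβ : rightForm x y = algebraMap K L b) :
    leftPart x ∈ R ∧ leftPart y ∈ R := by
  have key : ∀ z t : K10A F L, z ∈ odd F L L → z ∈ R → t ∈ R →
      t = algebraMap K L a • leftPart z + algebraMap K L b • rightPart z → leftPart z ∈ R := by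
    intro z t hz hzR ht h
    have : leftPart z = (a - b)⁻¹ • (t - b • z) := by
      rw [eq_inv_smul_iff₀ (sub_ne_zero.2 hab), h, algebraMap_smul, algebraMap_smul,
        show b • z = b • leftPart z + b • rightPart z by
          rw [← smul_add, leftPart_add_rightPart hz]]
      module
    rw [this]
    exact R.smul_mem _ (R.sub_mem ht (R.smul_mem _ hzR))
  refine ⟨key x _ hx hxR (R.nsmul_mem (hR _ (hR _ hxR _ hyR) _ hxR) 8) ?_,
    key y _ hy hyR (R.nsmul_mem (hR _ (hR _ hxR _ hyR) _ hyR) 8) ?_⟩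
  · rw [eight_nsmul_mul_self_left hL hx hy, hα, hβ]
  · rw [eight_nsmul_mul_self_right hL hx hy, hα, hβ]

lemma nonempty_superIso_of_symplectic_basis (hL : (2 : L) ≠ 0) (hb : ∀ i, ψ (bX i) = bL i)
    (hmul : ∀ x y, ψ (x * y) = ψ x * ψ y) (hev : ∀ x ∈ evX, ψ x ∈ even F L L)
    (hod : ∀ x ∈ odX, ψ x ∈ odd F L L) (hsup : evX ⊔ odX = ⊤) {u v w t : K10A F L}
    (hu : leftPart u ∈ LinearMap.range ψ) (hv : leftPart v ∈ LinearMap.range ψ)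
    (hw : rightPart w ∈ LinearMap.range ψ) (ht : rightPart t ∈ LinearMap.range ψ)
    (huv : leftForm u v = 1) (hwt : rightForm w t = 1) :
    Nonempty (SuperIso K X (K10A F K) evX odX (even F K K) (odd F K K)) := by
  let g : Fin 4 → L := ![u 6, u 7, v 6, v 7]
  let h : Fin 4 → L := ![w 8, w 9, t 8, t 9]
  have hg : g 0 * g 3 - g 1 * g 2 = 1 := huv
  have hh : h 0 * h 3 - h 1 * h 2 = 1 := hwt
  let φ := act (F := F) g h hg hh
  have hφ : ∀ x y, φ.symm (x * y) = φ.symm x * φ.symm y := fun x y =>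
    φ.injective <| by
      rw [show φ (φ.symm x * φ.symm y) = φ (φ.symm x) * φ (φ.symm y) from actFun_mul hg hh _ _]
      simp
  let ψ' : X →ₗ[K] K10A F L := φ.symm.toLinearMap.restrictScalars K ∘ₗ ψ
  have hψ' : ∀ x, ψ' x = φ.symm (ψ x) := fun _ => rfl
  have hmul' : ∀ x y, ψ' (x * y) = ψ' x * ψ' y := fun x y => by simp [hψ', hmul, hφ]
  have hev' : ∀ x ∈ evX, ψ' x ∈ even F L L := fun x hx => actFun_mem_even _ _ (hev x hx)
  have hod' : ∀ x ∈ odX, ψ' x ∈ odd F L L := fun x hx => actFun_mem_odd _ _ (hod x hx)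
  have hrange : ∀ y z, z ∈ LinearMap.range ψ → φ y = z → y ∈ LinearMap.range ψ' := by
    rintro y _ ⟨x, rfl⟩ hy
    exact ⟨x, by rw [hψ', ← hy, φ.symm_apply_apply]⟩
  have hfr : Module.finrank K X = 10 := by
    rw [Module.finrank_eq_nat_card_basis bX, ← Module.finrank_eq_nat_card_basis bL,
      finrank_eq_ten]
  refine nonempty_superIso_of_coord (φ.symm.injective.comp (injective_of_form hb)) hmul' hev'
    hod' hsup hfr fun x => coord_mem_fieldRange hL (R := LinearMap.range ψ') ?_ ?_ ?_
      (hrange _ _ hu ?_) (hrange _ _ hv ?_) (hrange _ _ hw ?_) (hrange _ _ ht ?_) ⟨x, rfl⟩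
  · rintro _ ⟨x, rfl⟩ _ ⟨y, rfl⟩
    exact ⟨x * y, hmul' x y⟩
  · rintro _ ⟨x, rfl⟩ hx c ⟨y, hy⟩
    refine scalar_descends hb (x := x) (y := y) (fun h₀ => hx (by rw [h₀, map_zero])) ?_
    apply φ.symm.injective
    rw [map_smul]
    exact hy.symm
  · rintro _ ⟨x, rfl⟩
    obtain ⟨y, hy, z, hz, rfl⟩ :=
      Submodule.mem_sup.1 (hsup ▸ Submodule.mem_top : x ∈ evX ⊔ odX)
    exact ⟨_, ⟨y, rfl⟩, _, ⟨z, rfl⟩, hev' y hy, hod' z hz, map_add _ _ _⟩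
  all_goals
    ext i
    fin_cases i <;>
      simp [φ, act_apply, actFun_apply, std_apply, leftPart_apply, rightPart_apply, g, h]

/-- A `K`-form of `K₁₀ ⊗ L` on which the two alternating forms take distinct values in `K` at
some pair of odd elements is split. -/
theorem nonempty_superIso_of_forms (hL : (2 : L) ≠ 0) (hb : ∀ i, ψ (bX i) = bL i)
    (hmul : ∀ x y, ψ (x * y) = ψ x * ψ y) (hev : ∀ x ∈ evX, ψ x ∈ even F L L)
    (hod : ∀ x ∈ odX, ψ x ∈ odd F L L) (hsup : evX ⊔ odX = ⊤) {m n : X} (hm : m ∈ odX)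
    (hn : n ∈ odX) {a b : K} (ha : a ≠ 0) (hab : a ≠ b)
    (hα : leftForm (ψ m) (ψ n) = algebraMap K L a)
    (hβ : rightForm (ψ m) (ψ n) = algebraMap K L b) :
    Nonempty (SuperIso K X (K10A F K) evX odX (even F K K) (odd F K K)) := by
  have hR : ∀ x ∈ LinearMap.range ψ, ∀ y ∈ LinearMap.range ψ, x * y ∈ LinearMap.range ψ := by
    rintro _ ⟨x, rfl⟩ _ ⟨y, rfl⟩
    exact ⟨x * y, hmul x y⟩
  obtain ⟨hm', hn'⟩ := leftPart_mem hL hR (hod m hm) (hod n hn) ⟨m, rfl⟩ ⟨n, rfl⟩ hab hα hβ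
  have hu : leftPart (a⁻¹ • ψ m) ∈ LinearMap.range ψ := by
    have : leftPart (a⁻¹ • ψ m) = a⁻¹ • leftPart (ψ m) := by
      ext i; fin_cases i <;> simp [leftPart_apply]
    rw [this]
    exact Submodule.smul_mem _ _ hm'
  have huv : leftForm (a⁻¹ • ψ m) (ψ n) = 1 := by
    have : leftForm (a⁻¹ • ψ m) (ψ n) = a⁻¹ • leftForm (ψ m) (ψ n) := by
      simp [leftForm, smul_sub]
    rw [this, hα, Algebra.smul_def, ← map_mul, inv_mul_cancel₀ ha, map_one]
  obtain ⟨z, hz, z', hz', hzz⟩ :=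
    exists_pairing_ne_zero hb hev hsup (c := 0) (d := 1) (Or.inr one_ne_zero)
  rw [zero_mul, zero_add, one_mul] at hzz
  have hright : ∀ y ∈ odX, rightPart (ψ y) ∈ LinearMap.range ψ := fun y hy =>
    rightPart_mem hL hR hu hn' huv (hod y hy) ⟨y, rfl⟩
  obtain ⟨u₀, hu₀⟩ := hu
  obtain ⟨y₀, hy₀⟩ : rightForm (ψ z) (ψ z') • ψ u₀ ∈ LinearMap.range ψ := by
    rw [hu₀, ← eight_nsmul_right_mul_right_mul_left hL]
    exact nsmul_mem (hR _ (hR _ (hright z hz) _ (hright z' hz')) _ ⟨u₀, hu₀⟩) 8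
  have hu₀' : u₀ ≠ 0 := fun h₀ => by
    rw [h₀, map_zero] at hu₀
    rw [← leftForm_leftPart, ← hu₀] at huv
    simp [leftForm] at huv
  obtain ⟨k, hk⟩ := scalar_descends hb hu₀' hy₀.symm
  have hk₀ : k ≠ 0 := fun h₀ => hzz (by rw [← hk, h₀, map_zero])
  refine nonempty_superIso_of_symplectic_basis hL hb hmul hev hod hsup (w := k⁻¹ • ψ z)
    ⟨u₀, hu₀⟩ hn' ?_ (hright z' hz') huv ?_
  · have : rightPart (k⁻¹ • ψ z) = k⁻¹ • rightPart (ψ z) := by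
      ext i; fin_cases i <;> simp [rightPart_apply]
    rw [this]
    exact Submodule.smul_mem _ _ (hright z hz)
  · have : rightForm (k⁻¹ • ψ z) (ψ z') = k⁻¹ • rightForm (ψ z) (ψ z') := by
      simp [rightForm, smul_sub]
    rw [this, ← hk, Algebra.smul_def, ← map_mul, inv_mul_cancel₀ hk₀, map_one]

end Core

section Descent

variable {F K L X ι : Type} [Field F] [Field K] [Field L] [Algebra F L]
  [Algebra K L] [AddCommGroup X] [Module K X] [Mul X]
  {odX : Submodule K X} {ψ : X →ₗ[K] K10A F L}
  {bX : Module.Basis ι K X} {bL : Module.Basis ι L (K10A F L)}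

lemma eight_nsmul_mul_mul_of_eq (hL : (2 : L) ≠ 0) {x y z : K10A F L} (hx : x ∈ odd F L L)
    (hy : y ∈ odd F L L) {α β : L} (hα : leftForm x y = α) (hβ : rightForm x y = β)
    (hz : z = α • leftPart x + β • rightPart x) :
    8 • (x * y * z) = (α * β - (α + β) ^ 2) • x + (2 * (α + β)) • z := by
  have hzo : z ∈ odd F L L := hz ▸ add_mem (Submodule.smul_mem _ _ (leftPart_mem_odd x))
    (Submodule.smul_mem _ _ (rightPart_mem_odd x))
  have h₁ : rightForm z y = β * β := by
    rw [← hβ] at hz ⊢; simp [hz, rightForm, leftPart_apply, rightPart_apply]; ring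
  have h₂ : leftForm z y = α * α := by
    rw [← hα] at hz ⊢; simp [hz, leftForm, leftPart_apply, rightPart_apply]; ring
  have h₃ : rightForm z x = 0 := by
    simp [hz, rightForm, leftPart_apply, rightPart_apply]; ring
  have h₄ : leftForm z x = 0 := by
    simp [hz, leftForm, leftPart_apply, rightPart_apply]; ring
  rw [eight_nsmul_mul_mul hL hx hy hzo, h₁, h₂, h₃, h₄, hα, hβ]
  have hx' : (α * β - (α + β) ^ 2) • x
      = (α * β - (α + β) ^ 2) • leftPart x + (α * β - (α + β) ^ 2) • rightPart x := by
    rw [← smul_add, leftPart_add_rightPart hx]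
  rw [hx', hz]
  module

/-- The sum and the product of the two alternating forms descend to a `K`-form. -/
lemma forms_add_mul_descend (hL : (2 : L) ≠ 0) (hb : ∀ i, ψ (bX i) = bL i)
    (hmul : ∀ x y, ψ (x * y) = ψ x * ψ y) (hod : ∀ x ∈ odX, ψ x ∈ odd F L L) {m n : X}
    (hm : m ∈ odX) (hn : n ∈ odX) :
    ∃ s p : K, leftForm (ψ m) (ψ n) + rightForm (ψ m) (ψ n) = algebraMap K L s ∧
      leftForm (ψ m) (ψ n) * rightForm (ψ m) (ψ n) = algebraMap K L p := by
  set α := leftForm (ψ m) (ψ n) with hα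
  set β := rightForm (ψ m) (ψ n) with hβ
  have hm' : ψ (8 • (m * n * m)) = α • leftPart (ψ m) + β • rightPart (ψ m) := by
    rw [map_nsmul, hmul, hmul, eight_nsmul_mul_self_left hL (hod m hm) (hod n hn)]
  by_cases hk : ∃ k : K, 8 • (m * n * m) = k • m
  · obtain ⟨k, hk⟩ := hk
    rw [hk, map_smul] at hm'
    have hcoord : ∀ i, algebraMap K L k * ψ m i
        = (α • leftPart (ψ m) + β • rightPart (ψ m)) i := fun i => by
      rw [← hm', smul_apply, Algebra.smul_def]
    have h6 := hcoord 6
    have h7 := hcoord 7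
    have h8 := hcoord 8
    have h9 := hcoord 9
    simp [leftPart_apply, rightPart_apply] at h6 h7 h8 h9
    have hαK : ∃ a : K, algebraMap K L a = α := by
      by_cases h : α = 0
      · exact ⟨0, by rw [h, map_zero]⟩
      · refine ⟨k, ?_⟩
        rcases h6 with h6 | h6
        · exact h6
        · rcases h7 with h7 | h7
          · exact h7
          · exact absurd (by simp [hα, leftForm, h6, h7]) h
    have hβK : ∃ b : K, algebraMap K L b = β := by
      by_cases h : β = 0
      · exact ⟨0, by rw [h, map_zero]⟩
      · refine ⟨k, ?_⟩
        rcases h8 with h8 | h8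
        · exact h8
        · rcases h9 with h9 | h9
          · exact h9
          · exact absurd (by simp [hβ, rightForm, h8, h9]) h
    obtain ⟨a, ha⟩ := hαK
    obtain ⟨b, hb'⟩ := hβK
    exact ⟨a + b, a * b, by rw [map_add, ha, hb'], by rw [map_mul, ha, hb']⟩
  · push Not at hk
    by_cases hm₀ : m = 0
    · refine ⟨0, 0, ?_, ?_⟩ <;> simp [hα, hβ, hm₀, leftForm, rightForm]
    have key := eight_nsmul_mul_mul_of_eq hL (hod m hm) (hod n hn) hα.symm hβ.symm hm'
    rw [← hmul, ← hmul, ← map_nsmul] at key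
    obtain ⟨⟨q, hq⟩, r, hr⟩ := pair_descends hb hm₀ hk key.symm
    have hs : α + β = algebraMap K L (r / 2) := by
      rw [map_div₀, hr, map_ofNat, mul_div_cancel_left₀ _ hL]
    refine ⟨r / 2, q + (r / 2) ^ 2, hs, ?_⟩
    rw [map_add, map_pow, ← hs, hq]
    ring

end Descent

section Tau

variable {F L : Type} [Field F] [Field L] [Algebra F L]

lemma leftForm_tau (x y : K10A F L) : leftForm (tau x) (tau y) = rightForm x y := rfl

lemma rightForm_tau (x y : K10A F L) : rightForm (tau x) (tau y) = leftForm x y := rfl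

lemma tau_apply (x : K10A F L) : tau x = tauFun F L x := rfl

lemma tau_mem_even {x : K10A F L} (hx : x ∈ even F L L) : tau x ∈ even F L L := by
  obtain ⟨h6, h7, h8, h9⟩ := mem_even.1 hx
  simp [mem_even, tau_apply, tauFun, *]

lemma tau_mem_odd {x : K10A F L} (hx : x ∈ odd F L L) : tau x ∈ odd F L L := by
  obtain ⟨h0, h1, h2, h3, h4, h5⟩ := mem_odd.1 hx
  simp [mem_odd, tau_apply, tauFun, *]

end Tau

end Kac.K10A

namespace Kac

open Polynomial IntermediateField in
lemma quadratic_adjoin {F E : Type} [Field F] [Field E] [Algebra F E] (h2 : (2 : F) ≠ 0) {x : E}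
    {s p : F} (hx : x ^ 2 - algebraMap F E s * x + algebraMap F E p = 0)
    (hxF : x ∉ (algebraMap F E).range) :
    Module.finrank F F⟮x⟯ = 2 ∧ Algebra.IsSeparable F F⟮x⟯ := by
  have hdeg : (X ^ 2 - C s * X + C p : F[X]).natDegree = 2 := by compute_degree!
  have hmonic : (X ^ 2 - C s * X + C p : F[X]).Monic := by monicity!
  have haeval : aeval x (X ^ 2 - C s * X + C p : F[X]) = 0 := by simpa using hx
  have hxint : IsIntegral F x := ⟨_, hmonic, haeval⟩
  have hmin : (minpoly F x).natDegree = 2 := by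
    refine le_antisymm ?_ ((minpoly.two_le_natDegree_iff hxint).2 hxF)
    rw [← hdeg]
    exact natDegree_le_of_dvd (minpoly.dvd F x haeval) hmonic.ne_zero
  refine ⟨by rw [adjoin.finrank hxint, hmin], (isSeparable_adjoin_simple_iff_isSeparable F E).2 ?_⟩
  refine (separable_iff_derivative_ne_zero (minpoly.irreducible hxint)).2 fun h => h2 ?_
  have h₁ := congrArg (fun q : F[X] => q.coeff 1) h
  have h₂ : (minpoly F x).coeff 2 = 1 := by
    rw [← hmin]
    exact minpoly.monic hxint
  simp only [coeff_derivative, h₂, coeff_zero] at h₁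
  norm_num at h₁
  exact h₁

namespace K10A

section BaseChange

variable {F K L A : Type} [Field F] [Field K] [Field L] [Algebra F K] [Algebra F L]
  [Algebra K L] [IsScalarTower F K L] [NonUnitalNonAssocRing A] [Module F A]
  [SMulCommClass F A A] [IsScalarTower F A A] {evA odA : Submodule F A}

/-- The `K`-form of `K₁₀ ⊗ L` defined by an `F`-form. -/
def formBaseChange (K : Type) [Field K] [Algebra F K] [Algebra K L] [IsScalarTower F K L]
    (e : L ⊗[F] A ≃ₗ[L] K10A F L) : K ⊗[F] A →ₗ[K] K10A F L :=
  e.toLinearMap.restrictScalars K ∘ₗ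
    TensorProduct.AlgebraTensorModule.map (Algebra.linearMap K L) LinearMap.id

omit [SMulCommClass F A A] [IsScalarTower F A A] in
lemma formBaseChange_tmul (e : L ⊗[F] A ≃ₗ[L] K10A F L) (k : K) (a : A) :
    formBaseChange K e (k ⊗ₜ a) = e (algebraMap K L k ⊗ₜ a) := rfl

lemma formBaseChange_mul {e : L ⊗[F] A ≃ₗ[L] K10A F L} (he : ∀ x y, e (x * y) = e x * e y)
    (x y : K ⊗[F] A) :
    formBaseChange K e (x * y) = formBaseChange K e x * formBaseChange K e y := by
  have hmap : ∀ x y : K ⊗[F] A,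
      TensorProduct.AlgebraTensorModule.map (Algebra.linearMap K L) (LinearMap.id : A →ₗ[F] A)
        (x * y) =
      TensorProduct.AlgebraTensorModule.map (Algebra.linearMap K L) (LinearMap.id : A →ₗ[F] A) x *
      TensorProduct.AlgebraTensorModule.map (Algebra.linearMap K L) (LinearMap.id : A →ₗ[F] A) y := by
    intro x y
    induction x with
    | zero => simp
    | add x₁ x₂ h₁ h₂ => rw [add_mul, map_add, map_add, add_mul, h₁, h₂]
    | tmul k a =>
      induction y with
      | zero => simp
      | add y₁ y₂ h₁ h₂ => rw [mul_add, map_add, map_add, mul_add, h₁, h₂]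
      | tmul k' a' => simp [Algebra.TensorProduct.tmul_mul_tmul]
  change e _ = e _ * e _
  rw [hmap, he]

omit [SMulCommClass F A A] [IsScalarTower F A A] in
lemma formBaseChange_mem {e : L ⊗[F] A ≃ₗ[L] K10A F L} {P : Submodule F A}
    {Q : Submodule L (K10A F L)} (h : ∀ a ∈ P, e (1 ⊗ₜ a) ∈ Q) {x : K ⊗[F] A}
    (hx : x ∈ P.baseChange K) : formBaseChange K e x ∈ Q := by
  have : P.baseChange K ≤ (Q.restrictScalars K).comap (formBaseChange K e) := by
    rw [Submodule.baseChange_eq_span, Submodule.span_le]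
    rintro _ ⟨a, ha, rfl⟩
    change formBaseChange K e (1 ⊗ₜ a) ∈ Q
    rw [formBaseChange_tmul, map_one]
    exact h a ha
  exact this hx

omit [SMulCommClass F A A] [IsScalarTower F A A] in
lemma baseChange_sup_eq_top (hsup : evA ⊔ odA = ⊤) :
    evA.baseChange K ⊔ odA.baseChange K = ⊤ := by
  rw [eq_top_iff, ← Submodule.baseChange_top, ← hsup, Submodule.baseChange_eq_span,
    Submodule.span_le]
  rintro _ ⟨a, ha, rfl⟩
  obtain ⟨x, hx, y, hy, rfl⟩ := Submodule.mem_sup.1 ha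
  change (1 : K) ⊗ₜ[F] (x + y) ∈ _
  rw [TensorProduct.tmul_add]
  exact Submodule.add_mem_sup (Submodule.tmul_mem_baseChange_of_mem _ hx)
    (Submodule.tmul_mem_baseChange_of_mem _ hy)

end BaseChange

end K10A

end Kac

namespace Kac.K10A

section Splitting

variable {F L A : Type} [Field F] [Field L] [Algebra F L] [NonUnitalNonAssocRing A] [Module F A]
  [SMulCommClass F A A] [IsScalarTower F A A] {evA odA : Submodule F A}

open IntermediateField in
lemma split_or_quadratic_of_forms (hL : (2 : L) ≠ 0) {e : L ⊗[F] A ≃ₗ[L] K10A F L}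
    (he : ∀ x y, e (x * y) = e x * e y) (hev : ∀ x ∈ evA, e (1 ⊗ₜ x) ∈ even F L L)
    (hod : ∀ x ∈ odA, e (1 ⊗ₜ x) ∈ odd F L L) (hsup : evA ⊔ odA = ⊤) {m n : A}
    (hm : m ∈ odA) (hn : n ∈ odA) (hα : leftForm (e (1 ⊗ₜ m)) (e (1 ⊗ₜ n)) ≠ 0)
    (hαβ : leftForm (e (1 ⊗ₜ m)) (e (1 ⊗ₜ n)) ≠ rightForm (e (1 ⊗ₜ m)) (e (1 ⊗ₜ n))) :
    Nonempty (SuperIso F A (K10A F F) evA odA (even F F F) (odd F F F)) ∨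
    ∃ K : IntermediateField F L,
      Module.finrank F K = 2 ∧ Algebra.IsSeparable F K ∧
      Nonempty (SuperIso K (K ⊗[F] A) (K10A F K)
        (evA.baseChange K) (odA.baseChange K) (even F K K) (odd F K K)) := by
  let ψ : A →ₗ[F] K10A F L := e.toLinearMap.restrictScalars F ∘ₗ TensorProduct.mk F L A 1
  have hψ : ∀ x, ψ x = e (1 ⊗ₜ x) := fun _ => rfl
  let bA := Module.Basis.ofVectorSpace F A
  let bL := (bA.baseChange L).map e
  have hb : ∀ i, ψ (bA i) = bL i := fun i => by
    rw [hψ, Module.Basis.map_apply, Module.Basis.baseChange_apply]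
  have hmul : ∀ x y, ψ (x * y) = ψ x * ψ y := fun x y => by
    rw [hψ, hψ, hψ, ← he, Algebra.TensorProduct.tmul_mul_tmul, one_mul]
  obtain ⟨s, p, hs, hp⟩ := forms_add_mul_descend hL hb hmul hod hm hn
  rw [hψ, hψ] at hs hp
  set α := leftForm (e (1 ⊗ₜ m)) (e (1 ⊗ₜ n)) with hα'
  set β := rightForm (e (1 ⊗ₜ m)) (e (1 ⊗ₜ n)) with hβ'
  by_cases hαF : α ∈ (algebraMap F L).range
  · obtain ⟨a, ha⟩ := hαF
    have hb' : β = algebraMap F L (s - a) := by rw [map_sub, ← hs, ha, add_sub_cancel_left]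
    refine Or.inl (nonempty_superIso_of_forms hL hb hmul hev hod hsup hm hn (a := a)
      (b := s - a) ?_ ?_ ha.symm hb')
    · rintro rfl
      exact hα (by rw [← ha, map_zero])
    · intro h
      exact hαβ (by rw [hb', ← h, ha])
  · have hF : (2 : F) ≠ 0 := fun h => hL (by rw [← map_ofNat (algebraMap F L) 2, h, map_zero])
    obtain ⟨hrank, hsep⟩ := quadratic_adjoin hF (x := α) (s := s) (p := p)
      (by rw [← hs, ← hp]; ring) hαF
    refine Or.inr ⟨F⟮α⟯, hrank, hsep, ?_⟩
    let a : F⟮α⟯ := ⟨α, mem_adjoin_simple_self F α⟩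
    have ha : algebraMap F⟮α⟯ L a = α := rfl
    have hb' : β = algebraMap F⟮α⟯ L (algebraMap F F⟮α⟯ s - a) := by
      rw [map_sub, ha, ← IsScalarTower.algebraMap_apply, ← hs, add_sub_cancel_left]
    have hone : ∀ x : A, formBaseChange F⟮α⟯ e (1 ⊗ₜ x) = e (1 ⊗ₜ x) := fun x => by
      rw [formBaseChange_tmul, map_one]
    refine nonempty_superIso_of_forms hL (ψ := formBaseChange F⟮α⟯ e)
      (bX := bA.baseChange F⟮α⟯) (bL := bL) ?_ (formBaseChange_mul he)
      (fun x hx => formBaseChange_mem hev hx) (fun x hx => formBaseChange_mem hod hx)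
      (baseChange_sup_eq_top hsup) (Submodule.tmul_mem_baseChange_of_mem 1 hm)
      (Submodule.tmul_mem_baseChange_of_mem 1 hn) (a := a) (b := algebraMap F F⟮α⟯ s - a)
      ?_ ?_ ?_ ?_
    · intro i
      rw [Module.Basis.baseChange_apply, hone]
      exact hb i
    · intro h
      exact hα (by rw [← ha, h, map_zero])
    · intro h
      exact hαβ (by rw [hb', ← h, ha])
    · rw [hone, hone, ha]
    · rw [hone, hone, ← hb']

theorem split_or_quadratic (hL : (2 : L) ≠ 0) {e : L ⊗[F] A ≃ₗ[L] K10A F L}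
    (he : ∀ x y, e (x * y) = e x * e y) (hev : ∀ x ∈ evA, e (1 ⊗ₜ x) ∈ even F L L)
    (hod : ∀ x ∈ odA, e (1 ⊗ₜ x) ∈ odd F L L) (hsup : evA ⊔ odA = ⊤) :
    Nonempty (SuperIso F A (K10A F F) evA odA (even F F F) (odd F F F)) ∨
    ∃ K : IntermediateField F L,
      Module.finrank F K = 2 ∧ Algebra.IsSeparable F K ∧
      Nonempty (SuperIso K (K ⊗[F] A) (K10A F K)
        (evA.baseChange K) (odA.baseChange K) (even F K K) (odd F K K)) := by
  let bA := Module.Basis.ofVectorSpace F A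
  obtain ⟨m, hm, n, hn, hmn⟩ := exists_pairing_ne_zero
    (ψ := e.toLinearMap.restrictScalars F ∘ₗ TensorProduct.mk F L A 1) (bX := bA)
    (bL := (bA.baseChange L).map e)
    (fun i => by rw [Module.Basis.map_apply, Module.Basis.baseChange_apply]; rfl)
    hev hsup (c := 1) (d := -1) (Or.inl one_ne_zero)
  have hne : leftForm (e (1 ⊗ₜ m)) (e (1 ⊗ₜ n)) ≠ rightForm (e (1 ⊗ₜ m)) (e (1 ⊗ₜ n)) :=
    fun h => hmn <| by
      change 1 * leftForm (e (1 ⊗ₜ m)) (e (1 ⊗ₜ n)) + -1 * rightForm (e (1 ⊗ₜ m)) (e (1 ⊗ₜ n)) = 0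
      rw [h]; ring
  by_cases hα : leftForm (e (1 ⊗ₜ m)) (e (1 ⊗ₜ n)) = 0
  · refine split_or_quadratic_of_forms hL (e := e.trans tau) (fun x y => ?_)
      (fun x hx => tau_mem_even (hev x hx)) (fun x hx => tau_mem_odd (hod x hx)) hsup hm hn
      ?_ ?_
    · simp only [LinearEquiv.trans_apply, he, tau_mul]
    · rw [LinearEquiv.trans_apply, LinearEquiv.trans_apply, leftForm_tau, ← hα]
      exact hne.symm
    · rw [LinearEquiv.trans_apply, LinearEquiv.trans_apply, leftForm_tau, rightForm_tau]
      exact hne.symm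
  · exact split_or_quadratic_of_forms hL he hev hod hsup hm hn hα hne

end Splitting

end Kac.K10A

/-! ### STATEMENT 7 -/

set_option synthInstance.maxHeartbeats 1000000 in
set_option maxHeartbeats 1000000 in
open Kac in
/-- Let `A` be a twisted form of `K₁₀` over `F`.  Then either `A ≅ K₁₀` as
`F`-superalgebras, or there is a quadratic separable field extension `K` of
`F` (inside the fixed algebraic closure `F̄`) such that
`A ⊗_F K ≅ K₁₀ ⊗_F K` as `K`-superalgebras.  Here `K₁₀ ⊗_F K` is realized as
`K10A F K`. -/
theorem twisted_form_K10_split_by_quadratic_extension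
    (F : Type) [Field F] (hchar : (2 : F) ≠ 0)
    (A : Type) [NonUnitalNonAssocRing A] [Module F A]
    [SMulCommClass F A A] [IsScalarTower F A A] [FiniteDimensional F A]
    (evA odA : Submodule F A) (hsuper : IsSuperalgebra F A evA odA)
    (htwist : Nonempty (SuperIso (AlgebraicClosure F)
      ((AlgebraicClosure F) ⊗[F] A) (K10A F (AlgebraicClosure F))
      (evA.baseChange (AlgebraicClosure F)) (odA.baseChange (AlgebraicClosure F))
      (K10A.even F (AlgebraicClosure F) (AlgebraicClosure F))
      (K10A.odd F (AlgebraicClosure F) (AlgebraicClosure F)))) :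
    Nonempty (SuperIso F A (K10A F F) evA odA (K10A.even F F F) (K10A.odd F F F)) ∨
    ∃ K : IntermediateField F (AlgebraicClosure F),
      Module.finrank F K = 2 ∧ Algebra.IsSeparable F K ∧
      Nonempty (SuperIso K (K ⊗[F] A) (K10A F K)
        (evA.baseChange K) (odA.baseChange K)
        (K10A.even F K K) (K10A.odd F K K)) := by
  obtain ⟨f⟩ := htwist
  refine K10A.split_or_quadratic (L := AlgebraicClosure F) ?_ f.map_mul'
    (fun x hx => ?_) (fun x hx => ?_) hsuper.1
  · rw [← map_ofNat (algebraMap F (AlgebraicClosure F)) 2]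
    exact (map_ne_zero _).2 hchar
  · exact f.map_even.le
      (Submodule.mem_map_of_mem (Submodule.tmul_mem_baseChange_of_mem 1 hx))
  · exact f.map_odd.le
      (Submodule.mem_map_of_mem (Submodule.tmul_mem_baseChange_of_mem 1 hx))
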